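/- Let 𝔤 be a non-abelian finite-dimensional Lie algebra over k with basis v_1, …, v_n and structure matrix B = ([v_i, v_j])_{ij} ∈ M_n(S𝔤), and put r(𝔤) = dim 𝔤 − i(𝔤). Then the fundamental semi-invariant of 𝔤 (the gcd of the r(𝔤)×r(𝔤) minors of B) is equal, up to a nonzero scalar, to the square of the greatest common divisor of the Pfaffians of the principal r(𝔤)×r(𝔤) minors of B. -/

import Mathlib

open Module MvPolynomial

namespace Paper

variable (k : Type) [Field k]

/-- The stabilizer `𝔤_x` of `x ∈ 𝔤*`. -/
def stab (L : Type) [LieRing L] [LieAlgebra k L] (x : Module.Dual k L) : Submodule k L where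
  carrier := {v | ∀ w, x ⁅v, w⁆ = 0}
  add_mem' := by intro a b ha hb w; simp [add_lie, ha w, hb w]
  zero_mem' := by intro w; simp
  smul_mem' := by intro c a ha w; simp [smul_lie, ha w]

/-- The index `i(𝔤)` of a Lie algebra: the minimal dimension of a stabilizer. -/
noncomputable def lieIndex (L : Type) [LieRing L] [LieAlgebra k L] : ℕ :=
  ⨅ x : Module.Dual k L, finrank k (stab k L x)

/-- The set of non-regular elements `𝔤* \ 𝔤*_reg`. -/
def nonReg (L : Type) [LieRing L] [LieAlgebra k L] : Set (Module.Dual k L) :=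
  {x | finrank k (stab k L x) ≠ lieIndex k L}

variable {k}
variable {L : Type} [LieRing L] [LieAlgebra k L]

/-- The element of the polynomial model of the symmetric algebra `S(V)`
(w.r.t. the basis `bV`) corresponding to a vector `v ∈ V`. -/
noncomputable def rep {ι V : Type} [Fintype ι] [AddCommGroup V] [Module k V]
    (bV : Basis ι k V) (v : V) : MvPolynomial ι k :=
  ∑ i, MvPolynomial.C (bV.repr v i) * MvPolynomial.X i

/-- The action of `v ∈ 𝔤` on the symmetric algebra `S(V)` of a `𝔤`-module `V`,
as a derivation (extending `w ↦ v · w = ⁅v, w⁆`). -/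
noncomputable def actDer {ι V : Type} [Fintype ι] [AddCommGroup V] [Module k V]
    [LieRingModule L V] (bV : Basis ι k V) (v : L) :
    Derivation k (MvPolynomial ι k) (MvPolynomial ι k) :=
  MvPolynomial.mkDerivation k fun i => rep bV ⁅v, bV i⁆

/-- Semi-invariants in `S(V)` for the action of a (sub)space `A` mapping to `𝔤` via `em`:
nonzero `f` with `a · f = χ(a) • f` for some weight `χ ∈ A*`. -/
noncomputable def semiInvSet {ι V A : Type} [Fintype ι] [AddCommGroup V] [Module k V]
    [LieRingModule L V] [AddCommGroup A] [Module k A]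
    (bV : Basis ι k V) (em : A → L) : Set (MvPolynomial ι k) :=
  {f | f ≠ 0 ∧ ∃ χ : Module.Dual k A, ∀ a : A, actDer bV (em a) f = χ a • f}

/-- The semi-center: the subalgebra generated by all semi-invariants. -/
noncomputable def semiCenter {ι V A : Type} [Fintype ι] [AddCommGroup V] [Module k V]
    [LieRingModule L V] [AddCommGroup A] [Module k A]
    (bV : Basis ι k V) (em : A → L) : Subalgebra k (MvPolynomial ι k) :=
  Algebra.adjoin k (semiInvSet bV em)

/-- The subalgebra of invariants in `S(V)`. -/
noncomputable def invariants {ι V A : Type} [Fintype ι] [AddCommGroup V] [Module k V]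
    [LieRingModule L V] (bV : Basis ι k V) (em : A → L) : Subalgebra k (MvPolynomial ι k) where
  carrier := {f | ∀ a : A, actDer bV (em a) f = 0}
  mul_mem' := by intro f g hf hg a; simp [Derivation.leibniz, hf a, hg a]
  one_mem' := by intro a; simp
  add_mem' := by intro f g hf hg a; simp [hf a, hg a]
  zero_mem' := by intro a; simp
  algebraMap_mem' := by intro c a; simp

/-- The structure matrix `B = ([v_i, v_j])_{ij}` of `𝔤` w.r.t. a basis. -/
noncomputable def structMat {ι : Type} [Fintype ι] (b : Basis ι k L) :
    Matrix ι ι (MvPolynomial ι k) :=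
  Matrix.of fun i j => rep b ⁅b i, b j⁆

/-- The set of `s × s` minors of the structure matrix. -/
noncomputable def minorsSet {ι : Type} [Fintype ι] [DecidableEq ι] (b : Basis ι k L) (s : ℕ) :
    Set (MvPolynomial ι k) :=
  {p | ∃ f g : Fin s ↪ ι, p = ((structMat b).submatrix f g).det}

/-- `g` is a greatest common divisor of the set `A`. -/
def IsGcdOf {α : Type} [CommMonoidWithZero α] (g : α) (A : Set α) : Prop :=
  (∀ a ∈ A, g ∣ a) ∧ ∀ c, (∀ a ∈ A, c ∣ a) → c ∣ g

/-- The Pfaffian of an `n × n` matrix (`n = 2m` even), via the standard formula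
`pf(A) = (2^m m!)⁻¹ Σ_σ sgn(σ) Π_i A_{σ(2i) σ(2i+1)}` (valid in characteristic zero). -/
noncomputable def pfaffian {n : ℕ} {R : Type} [CommRing R] [Algebra ℚ R]
    (A : Matrix (Fin n) (Fin n) R) : R :=
  ((2 ^ (n / 2) * (n / 2).factorial : ℚ)⁻¹) •
    ∑ σ : Equiv.Perm (Fin n), (Equiv.Perm.sign σ : ℤ) •
      ∏ i : Fin (n / 2),
        A (σ ⟨2 * i.1, by have := i.2; omega⟩) (σ ⟨2 * i.1 + 1, by have := i.2; omega⟩)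

/-- The set of Pfaffians of the principal `s × s` minors of the structure matrix. -/
noncomputable def principalPfaffians {ι : Type} [Fintype ι] [DecidableEq ι] [CharZero k]
    (b : Basis ι k L) (s : ℕ) : Set (MvPolynomial ι k) :=
  {p | ∃ f : Fin s ↪ ι, p = pfaffian ((structMat b).submatrix f f)}

/-- Evaluation of a polynomial in `S𝔤` at a point `x ∈ 𝔤*`. -/
noncomputable def evalAt {ι : Type} [Fintype ι] (b : Basis ι k L) (x : Module.Dual k L) :
    MvPolynomial ι k →ₐ[k] k :=
  MvPolynomial.aeval fun i => x (b i)

/-- The vanishing ideal of a subset `Z ⊆ 𝔤*`. -/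
noncomputable def vanIdeal {ι : Type} [Fintype ι] (b : Basis ι k L)
    (Z : Set (Module.Dual k L)) : Ideal (MvPolynomial ι k) where
  carrier := {f | ∀ x ∈ Z, evalAt b x f = 0}
  add_mem' := by intro f g hf hg x hx; simp [map_add, hf x hx, hg x hx]
  zero_mem' := by intro x hx; simp
  smul_mem' := by intro c f hf x hx; simp [smul_eq_mul, map_mul, hf x hx]

/-- The dimension (Krull dimension of the coordinate ring) of the Zariski closure of
a subset `Z ⊆ 𝔤*`. -/
noncomputable def closedDim {ι : Type} [Fintype ι] (b : Basis ι k L)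
    (Z : Set (Module.Dual k L)) : WithBot (WithTop ℕ) :=
  ringKrullDim (MvPolynomial ι k ⧸ vanIdeal b Z)

/-- The rank `r_𝔞(V)` of the structure matrix of the `𝔤`-module `V` with respect to a family
`vs` spanning the acting subalgebra `𝔞`, computed over the fraction field of `S(V)`. -/
noncomputable def rkFam {ι V κ : Type} [Fintype ι] [DecidableEq ι] [Fintype κ]
    [AddCommGroup V] [Module k V] [LieRingModule L V]
    (bV : Basis ι k V) (vs : κ → L) : ℕ :=
  Matrix.rank ((Matrix.of fun (j : ι) (i : κ) => rep bV ⁅vs i, bV j⁆).map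
    (algebraMap (MvPolynomial ι k) (FractionRing (MvPolynomial ι k))))

/-- The map `ρ : A ⊗_k 𝔤 → Der_k(A)` induced by an action of `𝔤` (given on a basis `bG`)
by derivations on a commutative `k`-algebra `A`; `ρ(a ⊗ v) = a • D(v)`. -/
noncomputable def rhoMap {A G κ : Type} [CommRing A] [Algebra k A]
    [AddCommGroup G] [Module k G]
    (bG : Basis κ k G) (D : G → Derivation k A A) :
    TensorProduct k A G →ₗ[A] (A →ₗ[k] A) :=
  (Basis.baseChange A bG).constr k fun i => (D (bG i)).toLinearMap

/-- The invariant subfield `F^𝔤` for an action of `𝔤` by derivations on a field `F ⊇ k`. -/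
noncomputable def invField {F G : Type} [Field F] [Algebra k F]
    (D : G → Derivation k F F) : IntermediateField k F where
  carrier := {x | ∀ v : G, D v x = 0}
  mul_mem' := by intro a b ha hb v; simp [Derivation.leibniz, ha v, hb v]
  one_mem' := by intro v; simp
  add_mem' := by intro a b ha hb v; simp [ha v, hb v]
  zero_mem' := by intro v; simp
  algebraMap_mem' := by intro c v; simp
  inv_mem' := by
    intro x hx v
    rcases eq_or_ne x 0 with h | h
    · simp [h]
    · have h1 : D v (x * x⁻¹) = 0 := by
        rw [mul_inv_cancel₀ h]; simp
      rw [Derivation.leibniz] at h1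
      have h2 : x • D v x⁻¹ = 0 := by
        rw [hx v] at h1; simpa using h1
      rcases smul_eq_zero.1 h2 with h3 | h3
      · exact absurd h3 h
      · exact h3

/-- The action of `𝔤` on a field `F` by derivations is *geometric* if the natural map
`F ⊗_{F^𝔤} 𝔤 → Der_{F^𝔤}(F)` is surjective, i.e. every `k`-derivation of `F` vanishing
on the invariant subfield `F^𝔤` lies in the `F`-span of the derivations coming from `𝔤`. -/
def IsGeometric {F G : Type} [Field F] [Algebra k F]
    (D : G → Derivation k F F) : Prop :=
  ∀ E : Derivation k F F, (∀ x : F, (∀ v : G, D v x = 0) → E x = 0) →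
    E.toLinearMap ∈ Submodule.span F (Set.range fun v : G => (D v).toLinearMap)


/-- The subalgebra of invariants for an action of `G` by derivations on a
commutative `k`-algebra `A`. -/
noncomputable def invariantsOf {A G : Type} [CommRing A] [Algebra k A]
    (D : G → Derivation k A A) : Subalgebra k A where
  carrier := {f | ∀ v : G, D v f = 0}
  mul_mem' := by intro f g hf hg v; simp [Derivation.leibniz, hf v, hg v]
  one_mem' := by intro v; simp
  add_mem' := by intro f g hf hg v; simp [hf v, hg v]
  zero_mem' := by intro v; simp
  algebraMap_mem' := by intro c v; simp

/-- The map `ρ* : S(V) ⊗ V → S(V) ⊗ 𝔤*` dual to the action map, determined by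
`ρ*(1 ⊗ w)(v) = v · w`. -/
noncomputable def rhoStar {ι ιV V : Type} [Fintype ι] [Fintype ιV]
    [AddCommGroup V] [Module k V] [LieRingModule L V]
    (b : Basis ι k L) (bV : Basis ιV k V) :
    TensorProduct k (MvPolynomial ιV k) V →ₗ[MvPolynomial ιV k]
      TensorProduct k (MvPolynomial ιV k) (Module.Dual k L) :=
  (Basis.baseChange (MvPolynomial ιV k) bV).constr k fun j =>
    ∑ i, (rep bV ⁅b i, bV j⁆) ⊗ₜ[k] (b.coord i)

/-- A bundled finite-dimensional Lie algebra over `k` together with a finite basis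
(providing a polynomial model of its symmetric algebra). -/
structure FDLieModel (k : Type) [Field k] where
  carrier : Type
  [lieRing : LieRing carrier]
  [lieAlg : LieAlgebra k carrier]
  ind : Type
  [fin : Fintype ind]
  [deceq : DecidableEq ind]
  basis : Basis ind k carrier

attribute [instance] FDLieModel.lieRing FDLieModel.lieAlg FDLieModel.fin FDLieModel.deceq

/-- The signed sum over permutations defining the Pfaffian, without its normalizing factor. -/
def pfSum {α R : Type*} [Fintype α] [DecidableEq α] [CommRing R]
    (A : Matrix (α × Fin 2) (α × Fin 2) R) : R :=
  ∑ σ : Equiv.Perm (α × Fin 2), ((Equiv.Perm.sign σ : ℤ) : R) * ∏ i, A (σ (i, 0)) (σ (i, 1))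

/-- Functions on `α × Fin 2` as families of pairs. -/
def pairsEquiv (α β : Type*) : (α × Fin 2 → β) ≃ (α → β × β) where
  toFun g i := (g (i, 0), g (i, 1))
  invFun f x := if x.2 = 0 then (f x.1).1 else (f x.1).2
  left_inv g := by
    funext ⟨i, t⟩
    fin_cases t <;> simp
  right_inv f := by
    funext i
    simp

theorem pfSum_mul_mul_transpose {α R : Type*} [Fintype α] [DecidableEq α] [CommRing R]
    (P A : Matrix (α × Fin 2) (α × Fin 2) R) :
    pfSum (P * A * P.transpose) = P.det * pfSum A := by
  have entry (σ : Equiv.Perm (α × Fin 2)) :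
      ∏ i, (P * A * P.transpose) (σ (i, 0)) (σ (i, 1)) =
        ∑ g : α × Fin 2 → α × Fin 2,
          (∏ i, A (g (i, 0)) (g (i, 1))) * ∏ x, P (σ x) (g x) := by
    have h (x y : α × Fin 2) : (P * A * P.transpose) x y =
        ∑ p : (α × Fin 2) × (α × Fin 2), P x p.1 * A p.1 p.2 * P y p.2 := by
      rw [Fintype.sum_prod_type, Finset.sum_comm]
      simp only [Matrix.mul_apply, Matrix.transpose_apply, Finset.sum_mul]
    simp only [h]
    rw [Finset.prod_univ_sum, Fintype.piFinset_univ, ← (pairsEquiv α (α × Fin 2)).sum_comp]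
    refine Finset.sum_congr rfl fun g _ => ?_
    rw [Fintype.prod_prod_type, ← Finset.prod_mul_distrib]
    refine Finset.prod_congr rfl fun i _ => ?_
    simp only [pairsEquiv, Equiv.coe_fn_mk, Fin.prod_univ_two]
    ring
  have collect (g : α × Fin 2 → α × Fin 2) :
      ∑ σ : Equiv.Perm (α × Fin 2), ((Equiv.Perm.sign σ : ℤ) : R) *
        ((∏ i, A (g (i, 0)) (g (i, 1))) * ∏ x, P (σ x) (g x)) =
        (∏ i, A (g (i, 0)) (g (i, 1))) * (P.submatrix id g).det := by
    rw [Matrix.det_apply', Finset.mul_sum]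
    refine Finset.sum_congr rfl fun σ _ => ?_
    simp only [Matrix.submatrix_apply, id]
    ring
  simp only [pfSum, entry, Finset.mul_sum]
  rw [Finset.sum_comm]
  simp only [collect]
  symm
  refine Fintype.sum_of_injective (fun σ : Equiv.Perm (α × Fin 2) => (σ : α × Fin 2 → α × Fin 2))
    DFunLike.coe_injective _ _ ?_ ?_
  · intro g hg
    have hinj : ¬ Function.Injective g := fun h =>
      hg ⟨Equiv.ofBijective g (Finite.injective_iff_bijective.1 h), rfl⟩
    simp only [Function.Injective, not_forall] at hinj
    obtain ⟨x, y, hxy, hne⟩ := hinj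
    rw [Matrix.det_zero_of_column_eq hne, mul_zero]
    intro z
    simp [hxy]
  · intro σ
    rw [Matrix.det_permute']
    ring

/-- The standard symplectic Gram matrix. -/
def stdSymplectic (α R : Type*) [DecidableEq α] [CommRing R] :
    Matrix (α × Fin 2) (α × Fin 2) R :=
  Matrix.kronecker (1 : Matrix α α R) !![0, 1; -1, 0]

theorem det_stdSymplectic (α R : Type*) [Fintype α] [DecidableEq α] [CommRing R] :
    (stdSymplectic α R).det = 1 := by
  simp [stdSymplectic, Matrix.det_kronecker, Matrix.det_fin_two]

/-- The permutation of `α × Fin 2` permuting the pairs by `p.1` after permuting the elements of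
each pair by `p.2`. -/
def pairPerm {α : Type*} (p : Equiv.Perm α × (α → Equiv.Perm (Fin 2))) :
    Equiv.Perm (α × Fin 2) :=
  (Equiv.prodCongrRight p.2).trans (Equiv.prodCongrLeft fun _ => p.1)

theorem pairPerm_apply {α : Type*} (p : Equiv.Perm α × (α → Equiv.Perm (Fin 2))) (i : α)
    (t : Fin 2) : pairPerm p (i, t) = (p.1 i, p.2 i t) := rfl

theorem pairPerm_injective {α : Type*} : Function.Injective (pairPerm (α := α)) := by
  rintro ⟨τ, s⟩ ⟨τ', s'⟩ h
  have key (i : α) (t : Fin 2) : (τ i, s i t) = (τ' i, s' i t) := by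
    rw [← pairPerm_apply (τ, s), h, pairPerm_apply]
  ext i
  · exact congrArg Prod.fst (key i 0)
  · rename_i t
    exact congrArg (fun x => (x.2 : ℕ)) (key i t)

theorem mem_range_pairPerm {α : Type*} [Finite α] (σ : Equiv.Perm (α × Fin 2))
    (h : ∀ i, (σ (i, 0)).1 = (σ (i, 1)).1) : σ ∈ Set.range (pairPerm (α := α)) := by
  have hfst (i : α) (t : Fin 2) : (σ (i, t)).1 = (σ (i, 0)).1 := by
    fin_cases t
    · rfl
    · exact (h i).symm
  have hτ : Function.Surjective fun i => (σ (i, 0)).1 := by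
    intro j
    obtain ⟨⟨i, t⟩, hi⟩ := σ.surjective (j, 0)
    exact ⟨i, by simp only [← hfst i t, hi]⟩
  have hs (i : α) : Function.Injective fun t => (σ (i, t)).2 := by
    intro t t' htt
    have := σ.injective (Prod.ext ((hfst i t).trans (hfst i t').symm) htt)
    exact congrArg Prod.snd this
  refine ⟨(Equiv.ofBijective _ (Finite.surjective_iff_bijective.1 hτ),
    fun i => Equiv.ofBijective _ (Finite.injective_iff_bijective.1 (hs i))), ?_⟩
  refine Equiv.ext fun ⟨i, t⟩ => ?_
  rw [pairPerm_apply]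
  exact Prod.ext (hfst i t).symm rfl

theorem pfSum_stdSymplectic (α R : Type*) [Fintype α] [DecidableEq α] [CommRing R] :
    pfSum (stdSymplectic α R) = 2 ^ Fintype.card α * (Fintype.card α).factorial := by
  have hcard : (Fintype.card (Equiv.Perm α × (α → Equiv.Perm (Fin 2))) : R) =
      2 ^ Fintype.card α * (Fintype.card α).factorial := by
    simp [Fintype.card_perm, mul_comm]
  rw [← hcard, pfSum, ← Finset.card_univ, Finset.cast_card]
  symm
  refine Fintype.sum_of_injective pairPerm pairPerm_injective _ _ ?_ ?_
  · intro σ hσ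
    have : ∃ i, (σ (i, 0)).1 ≠ (σ (i, 1)).1 := by
      by_contra! hall
      exact hσ (mem_range_pairPerm σ hall)
    obtain ⟨i, hi⟩ := this
    rw [Finset.prod_eq_zero (Finset.mem_univ i), mul_zero]
    simp [stdSymplectic, Matrix.one_apply_ne hi]
  · rintro ⟨τ, s⟩
    have hsign : Equiv.Perm.sign (pairPerm (τ, s)) = ∏ i, Equiv.Perm.sign (s i) := by
      have : pairPerm (τ, s) =
          (Equiv.prodCongrLeft fun _ => τ : Equiv.Perm (α × Fin 2)) * Equiv.prodCongrRight s := rfl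
      rw [this, map_mul, Equiv.Perm.sign_prodCongrLeft, Equiv.Perm.sign_prodCongrRight,
        Fin.prod_univ_two, Int.units_mul_self, one_mul]
    have hentry (u : Equiv.Perm (Fin 2)) :
        (!![0, 1; -1, 0] : Matrix (Fin 2) (Fin 2) ℤ) (u 0) (u 1) = Equiv.Perm.sign u := by
      revert u
      decide
    have hterm (i : α) : stdSymplectic α R (pairPerm (τ, s) (i, 0)) (pairPerm (τ, s) (i, 1)) =
        ((Equiv.Perm.sign (s i) : ℤ) : R) := by
      rw [pairPerm_apply, pairPerm_apply, ← hentry]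
      have hmap : (!![0, 1; -1, 0] : Matrix (Fin 2) (Fin 2) R) =
          (!![0, 1; -1, 0] : Matrix (Fin 2) (Fin 2) ℤ).map Int.cast := by
        ext a b
        fin_cases a <;> fin_cases b <;> simp
      simp [stdSymplectic, hmap]
    simp only [hsign, hterm, Units.coe_prod, Int.cast_prod, ← Finset.prod_mul_distrib]
    refine (Finset.prod_eq_one fun i _ => ?_).symm
    rw [← Int.cast_mul, ← Units.val_mul, Int.units_mul_self]
    simp

theorem exists_symplectic_family {K : Type*} [Field K] (m : ℕ) :
    ∀ {V : Type _} [AddCommGroup V] [Module K V] (B : LinearMap.BilinForm K V),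
      B.IsAlt → (∀ x, (∀ y, B x y = 0) → x = 0) → finrank K V = m * 2 →
      ∃ e : Fin m × Fin 2 → V, ∀ x y, B (e x) (e y) = stdSymplectic (Fin m) K x y := by
  induction m with
  | zero => exact fun _ _ _ _ => ⟨fun x => x.1.elim0, fun x => x.1.elim0⟩
  | succ m ih =>
    intro V _ _ B hB hnd hdim
    have : FiniteDimensional K V := FiniteDimensional.of_finrank_pos (by omega)
    have : Nontrivial V := nontrivial_of_finrank_pos (R := K) (by omega)
    obtain ⟨u, hu⟩ := exists_ne (0 : V)
    obtain ⟨v, huv⟩ : ∃ v, B u v = 1 := by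
      obtain ⟨w, hw⟩ : ∃ w, B u w ≠ 0 := by
        by_contra! h
        exact hu (hnd u h)
      exact ⟨(B u w)⁻¹ • w, by simp [hw]⟩
    have hvu : B v u = -1 := by rw [← hB.neg_eq, huv]
    let φ : V →ₗ[K] K × K := (B u).prod (B v)
    have hφ : Function.Surjective φ := by
      rintro ⟨a, c⟩
      refine ⟨a • v - c • u, ?_⟩
      simp [φ, huv, hvu, hB.self_eq_zero]
    let W := LinearMap.ker φ
    have hW (w : W) : B u w = 0 ∧ B v w = 0 := by
      have := w.2
      simpa [W, φ] using this
    have hW' (w : W) : B w u = 0 ∧ B w v = 0 := by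
      rw [← hB.neg_eq u, ← hB.neg_eq v, (hW w).1, (hW w).2]
      simp
    have hdimW : finrank K W = m * 2 := by
      have h := LinearMap.finrank_range_add_finrank_ker φ
      rw [LinearMap.range_eq_top.2 hφ, finrank_top, finrank_prod, finrank_self, hdim] at h
      have : finrank K W = finrank K (LinearMap.ker φ) := rfl
      omega
    obtain ⟨e, he⟩ := ih (B.restrict W) (fun w => hB w) (by
      intro x hx
      ext
      refine hnd x fun z => ?_
      have hz : z - B u z • v + B v z • u ∈ W := by
        simp [W, φ, huv, hvu, hB.self_eq_zero]
      have := hx ⟨_, hz⟩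
      simpa [(hW' x).1, (hW' x).2] using this) hdimW
    have he' (x y) : B (e x) (e y) = stdSymplectic (Fin m) K x y := he x y
    refine ⟨fun x => Fin.cases (![u, v] x.2) (fun i => (e (i, x.2) : V)) x.1, ?_⟩
    rintro ⟨i, s⟩ ⟨j, t⟩
    cases i using Fin.cases with
    | zero =>
      cases j using Fin.cases with
      | zero => fin_cases s <;> fin_cases t <;> simp [stdSymplectic, hB.self_eq_zero, huv, hvu]
      | succ j =>
        fin_cases s <;>
          simp [stdSymplectic, (hW _).1, (hW _).2, Matrix.one_apply_ne (Fin.succ_ne_zero j).symm]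
    | succ i =>
      cases j using Fin.cases with
      | zero =>
        fin_cases t <;>
          simp [stdSymplectic, (hW' _).1, (hW' _).2, Matrix.one_apply_ne (Fin.succ_ne_zero i)]
      | succ j => simp [he', stdSymplectic, Matrix.one_apply, Fin.succ_inj]

theorem pfSum_eq_zero_of_det_eq_zero {α K : Type*} [Fintype α] [DecidableEq α] [Field K]
    (A : Matrix (α × Fin 2) (α × Fin 2) K) (hA : A.transpose = -A) (hdet : A.det = 0) :
    pfSum A = 0 := by
  obtain ⟨v, hv, hvA⟩ := Matrix.exists_vecMul_eq_zero_iff.2 hdet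
  obtain ⟨j, hj⟩ := Function.ne_iff.1 hv
  have hAv : A.mulVec v = 0 := by
    rw [← Matrix.vecMul_transpose, hA, Matrix.vecMul_neg, hvA, neg_zero]
  let P : Matrix (α × Fin 2) (α × Fin 2) K := 1 - Matrix.vecMulVec (Pi.single j (v j)⁻¹) v
  have hvP : Matrix.vecMul v P = 0 := by
    have hj' : v j ≠ 0 := hj
    simp [P, Matrix.vecMul_sub, Matrix.vecMul_vecMulVec, hj']
  have hPdet : P.det = 0 := Matrix.exists_vecMul_eq_zero_iff.1 ⟨v, hv, hvP⟩
  have hPA : P * A * P.transpose = A := by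
    have h1 : P * A = A := by
      simp [P, sub_mul, Matrix.vecMulVec_mul, hvA]
    rw [h1]
    simp [P, mul_sub, Matrix.mul_vecMulVec, hAv]
  rw [← hPA, pfSum_mul_mul_transpose, hPdet, zero_mul]

theorem pfSum_sq_of_field {K : Type*} [Field K] [CharZero K] {m : ℕ}
    (A : Matrix (Fin m × Fin 2) (Fin m × Fin 2) K) (hA : A.transpose = -A) :
    pfSum A ^ 2 = (2 ^ m * m.factorial) ^ 2 * A.det := by
  by_cases hdet : A.det = 0
  · rw [pfSum_eq_zero_of_det_eq_zero A hA hdet, hdet]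
    simp
  obtain ⟨e, he⟩ := exists_symplectic_family m (Matrix.toBilin' A)
    (by
      intro x
      rw [← self_eq_neg, Matrix.toBilin'_apply']
      conv_lhs => rw [dotProduct_comm, ← Matrix.vecMul_transpose, hA, Matrix.vecMul_neg,
        neg_dotProduct, ← Matrix.dotProduct_mulVec])
    (by
      intro x hx
      by_contra hne
      refine hdet (Matrix.exists_vecMul_eq_zero_iff.1 ⟨x, hne, ?_⟩)
      funext j
      have := hx (Pi.single j 1)
      rw [Matrix.toBilin'_apply', Matrix.dotProduct_mulVec] at this
      simpa using this)
    (by simp)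
  let P : Matrix (Fin m × Fin 2) (Fin m × Fin 2) K := Matrix.of e
  have hP : P * A * P.transpose = stdSymplectic (Fin m) K := by
    ext x y
    rw [← he, Matrix.toBilin'_apply', Matrix.dotProduct_mulVec]
    rfl
  have h1 := congrArg Matrix.det hP
  rw [Matrix.det_mul, Matrix.det_mul, Matrix.det_transpose, det_stdSymplectic] at h1
  have h2 := congrArg pfSum hP
  rw [pfSum_mul_mul_transpose, pfSum_stdSymplectic, Fintype.card_fin] at h2
  rw [← h2]
  linear_combination (-(pfSum A) ^ 2) * h1

theorem pfSum_sq {R : Type*} [CommRing R] [IsDomain R] [CharZero R] {m : ℕ}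
    (A : Matrix (Fin m × Fin 2) (Fin m × Fin 2) R) (hA : A.transpose = -A) :
    pfSum A ^ 2 = (2 ^ m * m.factorial) ^ 2 * A.det := by
  let φ := algebraMap R (FractionRing R)
  have hφ : Function.Injective φ := IsFractionRing.injective R (FractionRing R)
  have : CharZero (FractionRing R) := charZero_of_injective_algebraMap hφ
  refine hφ ?_
  have h := pfSum_sq_of_field (A.map φ)
    (by rw [← Matrix.transpose_map, hA, Matrix.map_neg _ (map_neg φ)])
  have h1 : pfSum (A.map φ) = φ (pfSum A) := by simp [pfSum]
  have h2 : (A.map φ).det = φ A.det := (φ.map_det A).symm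
  rw [h1, h2] at h
  simpa only [map_mul, map_pow, map_ofNat, map_natCast] using h

theorem exists_row_basis {ι κ K : Type*} [Fintype ι] [Fintype κ] [Field K] (A : Matrix ι κ K)
    {r : ℕ} (hr : A.rank = r) :
    ∃ (I : Fin r → ι) (C : Matrix ι (Fin r) K),
      LinearIndependent K (A.submatrix I id).row ∧ A = C * A.submatrix I id := by
  rw [A.rank_eq_finrank_span_row] at hr
  subst hr
  obtain ⟨f, hf, hspan, hli⟩ := Submodule.exists_fun_fin_finrank_span_eq K (Set.range A.row)
  choose I hI using hf
  have hrow : (A.submatrix I id).row = f := funext hI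
  have hmem (i : ι) : A.row i ∈ Submodule.span K (Set.range f) :=
    by rw [hspan]; exact Submodule.subset_span ⟨i, rfl⟩
  simp only [Submodule.mem_span_range_iff_exists_fun] at hmem
  choose C hC using hmem
  refine ⟨I, Matrix.of C, hrow ▸ hli, ?_⟩
  ext i j
  rw [← Matrix.row_apply A i, ← hC i, Matrix.mul_apply, Finset.sum_apply]
  refine Finset.sum_congr rfl fun a _ => ?_
  rw [Pi.smul_apply, ← hI a]
  rfl

theorem det_submatrix_mul_comm_of_rank_le {ι K : Type*} [Fintype ι] [Field K]
    {r : ℕ} (A : Matrix ι ι K) (hA : A.rank ≤ r) (f g : Fin r → ι) :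
    (A.submatrix f g).det * (A.submatrix g f).det =
      (A.submatrix f f).det * (A.submatrix g g).det := by
  rcases hA.lt_or_eq with hlt | hr
  · have h (f g : Fin r → ι) : (A.submatrix f g).det = 0 := by
      by_contra hne
      have h1 := Matrix.rank_of_det_ne_zero hne
      have h2 := A.rank_submatrix_le f g
      rw [h1, Fintype.card_fin] at h2
      omega
    simp [h]
  · obtain ⟨I, C, -, hC⟩ := exists_row_basis A hr
    have h (f g : Fin r → ι) : (A.submatrix f g).det =
        (C.submatrix f id).det * (A.submatrix I g).det := by
      rw [← Matrix.det_mul]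
      congr 1
      conv_lhs => rw [hC]
      ext
      simp [Matrix.mul_apply]
    rw [h f g, h g f, h f f, h g g]
    ring

theorem even_rank_of_transpose_eq_neg {ι K : Type*} [Fintype ι] [Field K] [CharZero K]
    (A : Matrix ι ι K) (hA : A.transpose = -A) : Even A.rank := by
  obtain ⟨r, hr⟩ : ∃ r, A.rank = r := ⟨_, rfl⟩
  obtain ⟨I, C, hli, hC⟩ := exists_row_basis A hr
  rw [hr]
  by_contra hodd
  rw [Nat.not_even_iff_odd] at hodd
  have hskew : (A.submatrix I I).transpose = -A.submatrix I I := by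
    rw [Matrix.transpose_submatrix, hA, Matrix.submatrix_neg]
    rfl
  have hdet : (A.submatrix I I).det = 0 := by
    have h := Matrix.det_transpose (A.submatrix I I)
    rw [hskew, Matrix.det_neg, Fintype.card_fin, hodd.neg_one_pow, neg_one_mul] at h
    exact self_eq_neg.1 h.symm
  obtain ⟨v, hv, hvA⟩ := Matrix.exists_vecMul_eq_zero_iff.2 hdet
  have hfac : A.submatrix I id = A.submatrix I I * C.transpose := by
    have h := congrArg Matrix.transpose hC
    rw [Matrix.transpose_mul, Matrix.transpose_submatrix, hA, Matrix.submatrix_neg, Pi.neg_apply,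
      Pi.neg_apply, Matrix.neg_mul, neg_inj] at h
    conv_lhs => rw [h]
    ext
    simp [Matrix.mul_apply]
  have h0 : Matrix.vecMul v (A.submatrix I id) = 0 := by
    rw [hfac, ← Matrix.vecMul_vecMul, hvA, Matrix.zero_vecMul]
  exact hv (Matrix.vecMul_injective_iff.2 hli (h0.trans (Matrix.zero_vecMul _).symm))

theorem evalAt_rep {k L ι : Type} [Field k] [LieRing L] [LieAlgebra k L] [Fintype ι]
    (b : Basis ι k L) (x : Module.Dual k L) (v : L) : evalAt b x (rep b v) = x v := by
  conv_rhs => rw [← b.sum_repr v]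
  simp only [evalAt, rep, map_sum, map_mul, map_smul, MvPolynomial.aeval_C, MvPolynomial.aeval_X,
    Algebra.algebraMap_self, RingHom.id_apply, smul_eq_mul]

theorem structMat_transpose {k L ι : Type} [Field k] [LieRing L] [LieAlgebra k L] [Fintype ι]
    (b : Basis ι k L) : (structMat b).transpose = -structMat b := by
  ext1 i j
  rw [Matrix.transpose_apply, Matrix.neg_apply, structMat, Matrix.of_apply, Matrix.of_apply,
    ← lie_skew, rep, rep, map_neg]
  simp only [Finsupp.coe_neg, Pi.neg_apply, map_neg, neg_mul, Finset.sum_neg_distrib]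

theorem finrank_stab_add_rank {k L ι : Type} [Field k] [LieRing L] [LieAlgebra k L] [Fintype ι]
    (b : Basis ι k L) (x : Module.Dual k L) :
    finrank k (stab k L x) + ((structMat b).map (evalAt b x)).rank = finrank k L := by
  classical
  set M := (structMat b).map (evalAt b x) with hM
  have hMij (i j : ι) : M i j = x ⁅b i, b j⁆ := by
    rw [hM, Matrix.map_apply, structMat, Matrix.of_apply, evalAt_rep]
  have hcomap : stab k L x = (LinearMap.ker M.vecMulLinear).comap b.equivFun.toLinearMap := by
    ext v
    rw [Submodule.mem_comap, LinearMap.mem_ker, Matrix.vecMulLinear_apply]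
    have hval (j : ι) : Matrix.vecMul (b.equivFun v) M j = x ⁅v, b j⁆ := by
      conv_rhs => rw [← b.sum_equivFun v]
      simp only [Matrix.vecMul, dotProduct, hMij, sum_lie, smul_lie, map_sum, map_smul, smul_eq_mul]
    constructor
    · intro h
      funext j
      exact (hval j).trans (h (b j))
    · intro h w
      rw [← b.sum_repr w]
      simp only [lie_sum, lie_smul, map_sum, map_smul]
      refine Finset.sum_eq_zero fun j _ => ?_
      rw [← hval j, show Matrix.vecMul (b.equivFun v) M = 0 from h]
      simp
  have hker : finrank k (stab k L x) = finrank k (LinearMap.ker M.vecMulLinear) := by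
    rw [hcomap]
    exact (b.equivFun.ofSubmodule' _).finrank_eq
  have hrank : M.rank = finrank k (LinearMap.range M.vecMulLinear) := by
    rw [← Matrix.rank_transpose, Matrix.rank, Matrix.mulVecLin_transpose]
  rw [hker, hrank, add_comm, LinearMap.finrank_range_add_finrank_ker, finrank_eq_card_basis b]
  simp

theorem rank_map_evalAt_le {k L ι : Type} [Field k] [LieRing L] [LieAlgebra k L] [Fintype ι]
    (b : Basis ι k L) (x : Module.Dual k L) :
    ((structMat b).map (evalAt b x)).rank ≤ finrank k L - lieIndex k L := by
  have h := finrank_stab_add_rank b x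
  have h' : lieIndex k L ≤ finrank k (stab k L x) := ciInf_le (OrderBot.bddBelow _) x
  omega

theorem even_finrank_sub_lieIndex {k L ι : Type} [Field k] [CharZero k] [LieRing L]
    [LieAlgebra k L] [Fintype ι] (b : Basis ι k L) : Even (finrank k L - lieIndex k L) := by
  obtain ⟨x, hx⟩ : lieIndex k L ∈ Set.range fun x : Module.Dual k L => finrank k (stab k L x) :=
    Nat.sInf_mem (Set.range_nonempty _)
  have h := finrank_stab_add_rank b x
  have hrank : ((structMat b).map (evalAt b x)).rank = finrank k L - lieIndex k L := by
    simp only at hx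
    omega
  rw [← hrank]
  refine even_rank_of_transpose_eq_neg _ ?_
  rw [← Matrix.transpose_map, structMat_transpose, Matrix.map_neg _ (map_neg _)]

theorem det_structMat_submatrix_mul_comm {k L ι : Type} [Field k] [CharZero k] [LieRing L]
    [LieAlgebra k L] [Fintype ι] (b : Basis ι k L)
    (f g : Fin (finrank k L - lieIndex k L) → ι) :
    ((structMat b).submatrix f g).det * ((structMat b).submatrix g f).det =
      ((structMat b).submatrix f f).det * ((structMat b).submatrix g g).det := by
  refine MvPolynomial.funext fun c => ?_
  have hev : (MvPolynomial.eval c : MvPolynomial ι k →+* k) =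
      (evalAt b (b.constr k c)).toRingHom := by
    refine MvPolynomial.ringHom_ext (fun a => ?_) fun i => ?_
    · simp [evalAt]
    · rw [AlgHom.toRingHom_eq_coe, RingHom.coe_coe, evalAt, aeval_X, eval_X, Basis.constr_basis]
  have h (p : MvPolynomial ι k) : MvPolynomial.eval c p = evalAt b (b.constr k c) p := by
    rw [hev]
    rfl
  simp only [h, map_mul, AlgHom.map_det, AlgHom.mapMatrix_apply]
  exact det_submatrix_mul_comm_of_rank_le _ (rank_map_evalAt_le b _) f g

theorem pfaffian_eq_smul_pfSum {R : Type} [CommRing R] [Algebra ℚ R] {m : ℕ}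
    (A : Matrix (Fin (m * 2)) (Fin (m * 2)) R) :
    pfaffian A = ((2 ^ m * m.factorial : ℚ)⁻¹) •
      pfSum (A.submatrix finProdFinEquiv finProdFinEquiv) := by
  have hm : m * 2 / 2 = m := by omega
  refine congrArg₂ (· • ·) (by rw [hm]) ?_
  rw [pfSum, ← (finProdFinEquiv (m := m) (n := 2)).permCongr.sum_comp]
  refine Finset.sum_congr rfl fun σ _ => ?_
  rw [Equiv.Perm.sign_permCongr, zsmul_eq_mul]
  congr 1
  refine Fintype.prod_equiv (finCongr hm) _ _ fun i => ?_
  have h (t : Fin 2) (h' : 2 * i.1 + t.1 < m * 2) :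
      finProdFinEquiv.symm ⟨2 * i.1 + t.1, h'⟩ = (finCongr hm i, t) := by
    rw [Equiv.symm_apply_eq]
    ext
    simp [finProdFinEquiv, add_comm]
  have := i.2
  exact congrArg₂ A (congrArg (finProdFinEquiv ∘ σ) (h 0 (by simp only [Fin.val_zero]; omega)))
    (congrArg (finProdFinEquiv ∘ σ) (h 1 (by simp only [Fin.val_one]; omega)))

theorem pfaffian_sq {R : Type} [CommRing R] [IsDomain R] [Algebra ℚ R] {n : ℕ} (hn : Even n)
    (A : Matrix (Fin n) (Fin n) R) (hA : A.transpose = -A) : pfaffian A ^ 2 = A.det := by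
  obtain ⟨m, rfl⟩ : ∃ m, n = m * 2 := by
    obtain ⟨m, hm⟩ := hn
    exact ⟨m, by omega⟩
  have : CharZero R := algebraRat.charZero R
  have h := pfSum_sq (A.submatrix finProdFinEquiv finProdFinEquiv)
    (by rw [Matrix.transpose_submatrix, hA, Matrix.submatrix_neg]; rfl)
  have hc : (2 ^ m * m.factorial : ℚ) ≠ 0 := by positivity
  have hcast : (2 ^ m * m.factorial : R) ^ 2 = algebraMap ℚ R ((2 ^ m * m.factorial) ^ 2) := by
    simp only [map_mul, map_pow, map_ofNat, map_natCast]
  rw [pfaffian_eq_smul_pfSum, smul_pow, h, Matrix.det_submatrix_equiv_self, hcast,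
    ← Algebra.smul_def, smul_smul, ← mul_pow, inv_mul_cancel₀ hc, one_pow, one_smul]

theorem det_submatrix_associated {k L ι : Type} [Field k] [CharZero k] [LieRing L]
    [LieAlgebra k L] [Fintype ι] (b : Basis ι k L)
    (f g : Fin (finrank k L - lieIndex k L) → ι) :
    Associated ((structMat b).submatrix f g).det
      (pfaffian ((structMat b).submatrix f f) * pfaffian ((structMat b).submatrix g g)) := by
  have heven := even_finrank_sub_lieIndex b
  have hskew (f g : Fin (finrank k L - lieIndex k L) → ι) :
      ((structMat b).submatrix f g).transpose = -(structMat b).submatrix g f := by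
    rw [Matrix.transpose_submatrix, structMat_transpose, Matrix.submatrix_neg]
    rfl
  have hswap : ((structMat b).submatrix g f).det = ((structMat b).submatrix f g).det := by
    rw [← Matrix.det_transpose, hskew, Matrix.det_neg, Fintype.card_fin, heven.neg_one_pow,
      one_mul]
  have h := det_structMat_submatrix_mul_comm b f g
  rw [hswap, ← pfaffian_sq heven _ (hskew f f), ← pfaffian_sq heven _ (hskew g g), ← sq,
    ← mul_pow] at h
  rcases sq_eq_sq_iff_eq_or_eq_neg.1 h with h | h
  · rw [h]
  · rw [h]
    exact (Associated.refl _).neg_left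

theorem IsGcdOf.dvd_mul_of_forall_dvd_mul {α : Type} [CommMonoidWithZero α]
    [NormalizedGCDMonoid α] {d a c : α} {S : Set α} (hS : S.Finite) (hd : IsGcdOf d S)
    (h : ∀ x ∈ S, c ∣ a * x) : c ∣ a * d := by
  have h1 : c ∣ hS.toFinset.gcd fun x => a * x :=
    Finset.dvd_gcd fun x hx => h x (hS.mem_toFinset.1 hx)
  have h2 : hS.toFinset.gcd id ∣ d :=
    hd.2 _ fun x hx => Finset.gcd_dvd (f := id) (hS.mem_toFinset.2 hx)
  exact (h1.trans (Finset.gcd_mul_left' _ id a).dvd).trans (mul_dvd_mul_left a h2)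

theorem finite_principalPfaffians {k L ι : Type} [Field k] [CharZero k] [LieRing L]
    [LieAlgebra k L] [Fintype ι] [DecidableEq ι] (b : Basis ι k L) (s : ℕ) :
    (principalPfaffians b s).Finite := by
  refine (Set.finite_range fun f : Fin s ↪ ι =>
    pfaffian ((structMat b).submatrix f f)).subset ?_
  rintro p ⟨f, rfl⟩
  exact ⟨f, rfl⟩

/-- For non-abelian `𝔤`, the fundamental semi-invariant (the gcd of the
`r(𝔤) × r(𝔤)` minors of the structure matrix, `r(𝔤) = dim 𝔤 − i(𝔤)`) equals, up to a
nonzero scalar, the square of the gcd of the Pfaffians of the principal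
`r(𝔤) × r(𝔤)` minors. -/
theorem statement8 {k : Type} [Field k] [IsAlgClosed k] [CharZero k]
    {L : Type} [LieRing L] [LieAlgebra k L]
    {ι : Type} [Fintype ι] [DecidableEq ι] (b : Basis ι k L)
    (hnab : ∃ u v : L, ⁅u, v⁆ ≠ 0)
    (g gp : MvPolynomial ι k)
    (hg : IsGcdOf g (minorsSet b (finrank k L - lieIndex k L)))
    (hgp : IsGcdOf gp (principalPfaffians b (finrank k L - lieIndex k L))) :
    ∃ c : k, c ≠ 0 ∧ g = MvPolynomial.C c * gp ^ 2 := by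
  have : NormalizedGCDMonoid (MvPolynomial ι k) := Classical.choice inferInstance
  have hfin := finite_principalPfaffians b (finrank k L - lieIndex k L)
  have hassoc : Associated g (gp ^ 2) := by
    refine associated_of_dvd_dvd ?_ ?_
    · rw [sq]
      refine hgp.dvd_mul_of_forall_dvd_mul hfin fun x hx => ?_
      rw [mul_comm]
      refine hgp.dvd_mul_of_forall_dvd_mul hfin fun y hy => ?_
      obtain ⟨f, rfl⟩ := hx
      obtain ⟨f', rfl⟩ := hy
      exact (hg.1 _ ⟨f, f', rfl⟩).trans (det_submatrix_associated b f f').dvd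
    · refine hg.2 _ ?_
      rintro _ ⟨f, f', rfl⟩
      rw [sq]
      exact (mul_dvd_mul (hgp.1 _ ⟨f, rfl⟩) (hgp.1 _ ⟨f', rfl⟩)).trans
        (det_submatrix_associated b f f').symm.dvd
  obtain ⟨u, hu⟩ := hassoc.symm
  obtain ⟨c, hc, huc⟩ := MvPolynomial.isUnit_iff_eq_C_of_isReduced.1 u.isUnit
  exact ⟨c, hc.ne_zero, by rw [← hu, huc, mul_comm]⟩

end Paper
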